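/- arXiv:2203.04509 — 4 statements merged into one kernel-verified Lean document; each statement's English description precedes it below -/
import Mathlib

section
/- Let Ω ⊆ ℝ³ be open and let b : Ω → ℝ be a C⁴ real-valued biharmonic function (Δ²b = 0). Then the reduced-quaternion-valued function ∂b∂ is inframonogenic (i.e. ∂̄(∂b∂)∂̄ = 0) and the function ∂̄b∂̄ is antiinframonogenic (i.e. ∂(∂̄b∂̄)∂ = 0). -/
open Quaternion

noncomputable section

abbrev R3 := Fin 3 → ℝ

/-- Partial derivative `∂ᵢ` in the coordinate direction `i`. -/
noncomputable def pd {E : Type*} [NormedAddCommGroup E] [NormedSpace ℝ E]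
    (i : Fin 3) (f : R3 → E) (x : R3) : E :=
  fderiv ℝ f x (Pi.single i 1)

/-- The quaternion unit `e₁`. -/
def e1 : ℍ[ℝ] := ⟨0,1,0,0⟩
/-- The quaternion unit `e₂`. -/
def e2 : ℍ[ℝ] := ⟨0,0,1,0⟩
/-- The quaternion unit `e₃`. -/
def e3 : ℍ[ℝ] := ⟨0,0,0,1⟩

/-- The units `e₀ = 1, e₁, e₂`. -/
def eu : Fin 3 → ℍ[ℝ] := ![1, e1, e2]
/-- The signs `ε₀ = 1, ε₁ = ε₂ = −1`. -/
def eps : Fin 3 → ℝ := ![1, -1, -1]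

/-- The two-sided operator `∂̄f∂̄ = Σᵢⱼ eᵢ(∂ᵢ∂ⱼf)eⱼ`. -/
noncomputable def sandwichBar (f : R3 → ℍ[ℝ]) (x : R3) : ℍ[ℝ] :=
  ∑ i : Fin 3, ∑ j : Fin 3, eu i * pd i (pd j f) x * eu j

/-- The two-sided operator `∂f∂ = Σᵢⱼ εᵢεⱼ eᵢ(∂ᵢ∂ⱼf)eⱼ`. -/
noncomputable def sandwich (f : R3 → ℍ[ℝ]) (x : R3) : ℍ[ℝ] :=
  ∑ i : Fin 3, ∑ j : Fin 3, (eps i * eps j) • (eu i * pd i (pd j f) x * eu j)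

/-- The Laplacian `Δ = ∂₀² + ∂₁² + ∂₂²`. -/
noncomputable def lap {E : Type*} [NormedAddCommGroup E] [NormedSpace ℝ E]
    (f : R3 → E) (x : R3) : E :=
  pd 0 (pd 0 f) x + pd 1 (pd 1 f) x + pd 2 (pd 2 f) x

/-- The left Cauchy–Riemann operator `∂̄f = ∂₀f + e₁(∂₁f) + e₂(∂₂f)`. -/
noncomputable def DbarL (f : R3 → ℍ[ℝ]) (x : R3) : ℍ[ℝ] :=
  pd 0 f x + e1 * pd 1 f x + e2 * pd 2 f x

/-- The left conjugate Cauchy–Riemann operator `∂f = ∂₀f − e₁(∂₁f) − e₂(∂₂f)`. -/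
noncomputable def DL (f : R3 → ℍ[ℝ]) (x : R3) : ℍ[ℝ] :=
  pd 0 f x - e1 * pd 1 f x - e2 * pd 2 f x

/-- The right Cauchy–Riemann operator `f∂̄ = ∂₀f + (∂₁f)e₁ + (∂₂f)e₂`. -/
noncomputable def DbarR (f : R3 → ℍ[ℝ]) (x : R3) : ℍ[ℝ] :=
  pd 0 f x + pd 1 f x * e1 + pd 2 f x * e2

/-- The right conjugate Cauchy–Riemann operator `f∂ = ∂₀f − (∂₁f)e₁ − (∂₂f)e₂`. -/
noncomputable def DR (f : R3 → ℍ[ℝ]) (x : R3) : ℍ[ℝ] :=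
  pd 0 f x - pd 1 f x * e1 - pd 2 f x * e2

section PartialDerivatives

variable {E : Type*} [NormedAddCommGroup E] [NormedSpace ℝ E] {Ω : Set R3}

lemma eqOn_pd (hΩ : IsOpen Ω) {f g : R3 → E} (h : Set.EqOn f g Ω) (i : Fin 3) :
    Set.EqOn (pd i f) (pd i g) Ω := fun x hx => by
  unfold pd
  rw [(h.eventuallyEq_of_mem (hΩ.mem_nhds hx)).fderiv_eq]

lemma contDiffOn_pd (hΩ : IsOpen Ω) {f : R3 → E} {n m : WithTop ℕ∞} (h : ContDiffOn ℝ n f Ω)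
    (hmn : m + 1 ≤ n) (i : Fin 3) : ContDiffOn ℝ m (pd i f) Ω :=
  (h.fderiv_of_isOpen hΩ hmn).clm_apply contDiffOn_const

lemma pd_pd_eq_fderiv_fderiv (hΩ : IsOpen Ω) {f : R3 → E} (h : ContDiffOn ℝ 2 f Ω) (i j : Fin 3)
    {x : R3} (hx : x ∈ Ω) :
    pd i (pd j f) x = fderiv ℝ (fderiv ℝ f) x (Pi.single i 1) (Pi.single j 1) := by
  have hd : DifferentiableAt ℝ (fderiv ℝ f) x :=
    ((h.fderiv_of_isOpen (m := 1) hΩ (by norm_num)).differentiableOn (by norm_num)).differentiableAt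
      (hΩ.mem_nhds hx)
  change fderiv ℝ (fun y => fderiv ℝ f y (Pi.single j 1)) x (Pi.single i 1) = _
  rw [fderiv_clm_apply hd (differentiableAt_const _)]
  simp

lemma pd_comm (hΩ : IsOpen Ω) {f : R3 → E} (h : ContDiffOn ℝ 2 f Ω) (i j : Fin 3) :
    Set.EqOn (pd i (pd j f)) (pd j (pd i f)) Ω := fun x hx => by
  rw [pd_pd_eq_fderiv_fderiv hΩ h i j hx, pd_pd_eq_fderiv_fderiv hΩ h j i hx]
  exact ((h.contDiffAt (hΩ.mem_nhds hx)).isSymmSndFDerivAt (by simp)) _ _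

lemma pd_sum_smul (hΩ : IsOpen Ω) {ι : Type*} [Fintype ι] {h : ι → R3 → ℝ} (c : ι → E)
    (hh : ∀ p, ContDiffOn ℝ 1 (h p) Ω) (k : Fin 3) :
    Set.EqOn (pd k fun y => ∑ p, h p y • c p) (fun y => ∑ p, pd k (h p) y • c p) Ω := by
  intro x hx
  have hd : ∀ p, DifferentiableAt ℝ (h p) x := fun p =>
    ((hh p).differentiableOn (by norm_num)).differentiableAt (hΩ.mem_nhds hx)
  have : HasFDerivAt (fun y => ∑ p, h p y • c p)
      (∑ p, (fderiv ℝ (h p) x).smulRight (c p)) x :=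
    HasFDerivAt.fun_sum fun p _ => (hd p).hasFDerivAt.smul_const (c p)
  simp [pd, this.fderiv]

lemma pd_pd_sum_smul (hΩ : IsOpen Ω) {ι : Type*} [Fintype ι] {h : ι → R3 → ℝ} (c : ι → E)
    (hh : ∀ p, ContDiffOn ℝ 2 (h p) Ω) (k l : Fin 3) :
    Set.EqOn (pd k (pd l fun y => ∑ p, h p y • c p))
      (fun y => ∑ p, pd k (pd l (h p)) y • c p) Ω :=
  (eqOn_pd hΩ (pd_sum_smul hΩ c (fun p => (hh p).of_le (by norm_num)) l) k).trans
    (pd_sum_smul hΩ c (fun p => contDiffOn_pd hΩ (hh p) (by norm_num) l) k)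

lemma pd_pd_coe (hΩ : IsOpen Ω) {b : R3 → ℝ} (hb : ContDiffOn ℝ 2 b Ω) (i j : Fin 3) :
    Set.EqOn (pd i (pd j fun y => (b y : ℍ[ℝ]))) (fun y => ((pd i (pd j b) y : ℝ) : ℍ[ℝ])) Ω := by
  have key := pd_pd_sum_smul hΩ (fun _ : Unit => (1 : ℍ[ℝ])) (fun _ => hb) i j
  simpa [← Quaternion.coe_mul_eq_smul] using key

end PartialDerivatives

lemma sandwich_coe {Ω : Set R3} (hΩ : IsOpen Ω) {b : R3 → ℝ} (hb : ContDiffOn ℝ 2 b Ω) :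
    Set.EqOn (sandwich fun y => (b y : ℍ[ℝ]))
      (fun y => ∑ p : Fin 3 × Fin 3, pd p.1 (pd p.2 b) y •
        ((eps p.1 * eps p.2) • (eu p.1 * eu p.2))) Ω := by
  intro x hx
  simp only [sandwich, Fintype.sum_prod_type]
  refine Finset.sum_congr rfl fun i _ => Finset.sum_congr rfl fun j _ => ?_
  rw [pd_pd_coe hΩ hb i j hx, Quaternion.mul_coe_eq_smul, smul_mul_assoc, smul_comm]

lemma sandwichBar_coe {Ω : Set R3} (hΩ : IsOpen Ω) {b : R3 → ℝ} (hb : ContDiffOn ℝ 2 b Ω) :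
    Set.EqOn (sandwichBar fun y => (b y : ℍ[ℝ]))
      (fun y => ∑ p : Fin 3 × Fin 3, pd p.1 (pd p.2 b) y • (eu p.1 * eu p.2)) Ω := by
  intro x hx
  simp only [sandwichBar, Fintype.sum_prod_type]
  refine Finset.sum_congr rfl fun i _ => Finset.sum_congr rfl fun j _ => ?_
  rw [pd_pd_coe hΩ hb i j hx, Quaternion.mul_coe_eq_smul, smul_mul_assoc]

lemma lap_lap {Ω : Set R3} (hΩ : IsOpen Ω) {b : R3 → ℝ} (hb : ContDiffOn ℝ 4 b Ω) :
    Set.EqOn (lap (lap b)) (fun x => ∑ i : Fin 3, ∑ j : Fin 3, pd i (pd i (pd j (pd j b))) x) Ω := by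
  have hsum : lap b = fun y => ∑ j : Fin 3, pd j (pd j b) y • (1 : ℝ) := by
    funext y
    simp [lap, Fin.sum_univ_three]
  have h2 : ∀ j, ContDiffOn ℝ 2 (pd j (pd j b)) Ω := fun j =>
    contDiffOn_pd hΩ (contDiffOn_pd (m := 3) hΩ hb (by norm_num) j) (by norm_num) j
  intro x hx
  have key : ∀ i, pd i (pd i (lap b)) x = ∑ j : Fin 3, pd i (pd i (pd j (pd j b))) x := fun i => by
    rw [hsum, pd_pd_sum_smul hΩ (fun _ => (1 : ℝ)) h2 i i hx]
    simp
  rw [lap, key, key, key, ← Fin.sum_univ_three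
    (fun i => ∑ j : Fin 3, pd i (pd i (pd j (pd j b))) x)]

section SymbolAlgebra

@[simp] lemma e1_re : e1.re = 0 := rfl
@[simp] lemma e1_imI : e1.imI = 1 := rfl
@[simp] lemma e1_imJ : e1.imJ = 0 := rfl
@[simp] lemma e1_imK : e1.imK = 0 := rfl
@[simp] lemma e2_re : e2.re = 0 := rfl
@[simp] lemma e2_imI : e2.imI = 0 := rfl
@[simp] lemma e2_imJ : e2.imJ = 1 := rfl
@[simp] lemma e2_imK : e2.imK = 0 := rfl

variable {D : Fin 3 → Fin 3 → Fin 3 → Fin 3 → ℝ}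

lemma sum_sandwichBar_sandwich_eq_zero (outer : ∀ k l i j, D k l i j = D l k i j)
    (middle : ∀ k l i j, D k l i j = D k i l j) (inner : ∀ k l i j, D k l i j = D k l j i)
    (hD : ∑ i, ∑ j, D i i j j = 0) :
    ∑ k, ∑ l, eu k * (∑ p : Fin 3 × Fin 3,
      D k l p.1 p.2 • ((eps p.1 * eps p.2) • (eu p.1 * eu p.2))) * eu l = 0 := by
  have o10 := outer 1 0
  have o20 := outer 2 0
  have o21 := outer 2 1
  have m10 := fun k => middle k 1 0
  have m20 := fun k => middle k 2 0
  have m21 := fun k => middle k 2 1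
  have i10 := fun k l => inner k l 1 0
  have i20 := fun k l => inner k l 2 0
  have i21 := fun k l => inner k l 2 1
  simp only [Fin.sum_univ_three, Fintype.sum_prod_type,
    o10, o20, o21, m10, m20, m21, i10, i20, i21] at hD ⊢
  ext
  · simp [eu, eps]
    linear_combination hD
  all_goals
    simp [eu, eps]
    ring

lemma sum_sandwich_sandwichBar_eq_zero (outer : ∀ k l i j, D k l i j = D l k i j)
    (middle : ∀ k l i j, D k l i j = D k i l j) (inner : ∀ k l i j, D k l i j = D k l j i)
    (hD : ∑ i, ∑ j, D i i j j = 0) :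
    ∑ k, ∑ l, (eps k * eps l) • (eu k * (∑ p : Fin 3 × Fin 3,
      D k l p.1 p.2 • (eu p.1 * eu p.2)) * eu l) = 0 := by
  have o10 := outer 1 0
  have o20 := outer 2 0
  have o21 := outer 2 1
  have m10 := fun k => middle k 1 0
  have m20 := fun k => middle k 2 0
  have m21 := fun k => middle k 2 1
  have i10 := fun k l => inner k l 1 0
  have i20 := fun k l => inner k l 2 0
  have i21 := fun k l => inner k l 2 1
  simp only [Fin.sum_univ_three, Fintype.sum_prod_type,
    o10, o20, o21, m10, m20, m21, i10, i20, i21] at hD ⊢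
  ext
  · simp [eu, eps]
    linear_combination hD
  all_goals
    simp [eu, eps]
    ring

end SymbolAlgebra

/-- If `b` is a real-valued C⁴ biharmonic function on an open set `Ω ⊆ ℝ³`,
then `∂b∂` is inframonogenic and `∂̄b∂̄` is antiinframonogenic on `Ω`. -/
theorem stmt0 (Ω : Set R3) (hΩ : IsOpen Ω) (b : R3 → ℝ)
    (hb : ContDiffOn ℝ 4 b Ω)
    (hbih : ∀ x ∈ Ω, lap (lap b) x = 0) :
    (∀ x ∈ Ω, sandwichBar (sandwich (fun y => (b y : ℍ[ℝ]))) x = 0) ∧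
    (∀ x ∈ Ω, sandwich (sandwichBar (fun y => (b y : ℍ[ℝ]))) x = 0) := by
  have h3 : ∀ j, ContDiffOn ℝ 3 (pd j b) Ω := contDiffOn_pd hΩ hb (by norm_num)
  have h2 : ∀ i j, ContDiffOn ℝ 2 (pd i (pd j b)) Ω := fun i j =>
    contDiffOn_pd hΩ (h3 j) (by norm_num) i
  have hb2 : ContDiffOn ℝ 2 b Ω := hb.of_le (by norm_num)
  have outer : ∀ x ∈ Ω, ∀ k l i j,
      pd k (pd l (pd i (pd j b))) x = pd l (pd k (pd i (pd j b))) x := fun x hx k l i j =>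
    pd_comm hΩ (h2 i j) k l hx
  have middle : ∀ x ∈ Ω, ∀ k l i j,
      pd k (pd l (pd i (pd j b))) x = pd k (pd i (pd l (pd j b))) x := fun x hx k l i j =>
    eqOn_pd hΩ (pd_comm hΩ ((h3 j).of_le (by norm_num)) l i) k hx
  have inner : ∀ x ∈ Ω, ∀ k l i j,
      pd k (pd l (pd i (pd j b))) x = pd k (pd l (pd j (pd i b))) x := fun x hx k l i j =>
    eqOn_pd hΩ (eqOn_pd hΩ (pd_comm hΩ hb2 i j) l) k hx
  have hD : ∀ x ∈ Ω, ∑ i, ∑ j, pd i (pd i (pd j (pd j b))) x = 0 := fun x hx =>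
    (lap_lap hΩ hb hx).symm.trans (hbih x hx)
  constructor <;> intro x hx
  · refine Eq.trans ?_ (sum_sandwichBar_sandwich_eq_zero
      (D := fun k l i j => pd k (pd l (pd i (pd j b))) x)
      (outer x hx) (middle x hx) (inner x hx) (hD x hx))
    refine Finset.sum_congr rfl fun k _ => Finset.sum_congr rfl fun l _ => ?_
    rw [eqOn_pd hΩ (eqOn_pd hΩ (sandwich_coe hΩ hb2) l) k hx,
      pd_pd_sum_smul hΩ _ (fun p : Fin 3 × Fin 3 => h2 p.1 p.2) k l hx]
  · refine Eq.trans ?_ (sum_sandwich_sandwichBar_eq_zero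
      (D := fun k l i j => pd k (pd l (pd i (pd j b))) x)
      (outer x hx) (middle x hx) (inner x hx) (hD x hx))
    refine Finset.sum_congr rfl fun k _ => Finset.sum_congr rfl fun l _ => ?_
    rw [eqOn_pd hΩ (eqOn_pd hΩ (sandwichBar_coe hΩ hb2) l) k hx,
      pd_pd_sum_smul hΩ _ (fun p : Fin 3 × Fin 3 => h2 p.1 p.2) k l hx]
end
end

section
/- Let B ⊆ ℝ³ be an open ball and let f₀ : B → ℝ be a C² scalar-valued inframonogenic function, i.e. ∂̄f₀∂̄ = 0. Then there exist real constants c₀, c₁, c₂ and a harmonic function h of the two variables (x₁, x₂) such that f₀(x₀, x₁, x₂) = c₀(2x₀² + x₁² + x₂²) + c₁x₀ + c₂ + h(x₁, x₂) for all (x₀, x₁, x₂) ∈ B. -/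
open Quaternion

noncomputable section

/-- Partial derivative for functions of two real variables. -/
noncomputable def pd2 (i : Fin 2) (h : (Fin 2 → ℝ) → ℝ) (y : Fin 2 → ℝ) : ℝ :=
  fderiv ℝ h y (Pi.single i 1)

/-- A function whose derivative kills `x - y` throughout a convex set takes equal values at
`x` and `y`. -/
theorem eq_of_fderiv_sub_eq_zero {E : Type*} [NormedAddCommGroup E] [NormedSpace ℝ E]
    {s : Set E} (hs : Convex ℝ s) (ho : IsOpen s) {g : E → ℝ} (hg : DifferentiableOn ℝ g s)
    {x y : E} (hx : x ∈ s) (hy : y ∈ s) (h0 : ∀ z ∈ s, fderiv ℝ g z (x - y) = 0) :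
    g x = g y := by
  obtain ⟨z, hz, hzeq⟩ := domain_mvt (f := g) (f' := fderiv ℝ g) (s := s) (x := y) (y := x)
    (fun z hz => ((hg z hz).differentiableAt (ho.mem_nhds hz)).hasFDerivAt.hasFDerivWithinAt)
    hs hy hx
  rw [h0 z (hs.segment_subset hy hx hz)] at hzeq
  linarith

/-- A function whose derivative kills `x - y` throughout an open convex set has equal derivatives
at `x` and `y`. -/
theorem fderiv_eq_of_fderiv_sub_eq_zero {E : Type*} [NormedAddCommGroup E] [NormedSpace ℝ E]
    {s : Set E} (hs : Convex ℝ s) (ho : IsOpen s) {g : E → ℝ} (hg : DifferentiableOn ℝ g s)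
    {x y : E} (hx : x ∈ s) (hy : y ∈ s) (h0 : ∀ z ∈ s, fderiv ℝ g z (x - y) = 0) :
    fderiv ℝ g x = fderiv ℝ g y := by
  have hev : (fun z => g (z + (x - y))) =ᶠ[nhds y] g := by
    have hc : ContinuousAt (fun z => z + (x - y)) y := by fun_prop
    have h1 : ∀ᶠ z in nhds y, z + (x - y) ∈ s :=
      hc.eventually_mem (ho.mem_nhds (by simpa using hx))
    filter_upwards [h1, ho.mem_nhds hy] with z hz1 hz2
    exact eq_of_fderiv_sub_eq_zero hs ho hg hz1 hz2 (fun w hw => by simpa using h0 w hw)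
  have h := hev.fderiv_eq (𝕜 := ℝ)
  rw [fderiv_comp_add_right] at h
  simpa using h

theorem fderiv_apply_eq_sum_pd {g : R3 → ℝ} (z v : R3) :
    fderiv ℝ g z v = v 0 * pd 0 g z + v 1 * pd 1 g z + v 2 * pd 2 g z := by
  have hv : v = v 0 • (Pi.single 0 1 : R3) + v 1 • (Pi.single 1 1 : R3) +
      v 2 • (Pi.single 2 1 : R3) := by
    ext i; fin_cases i <;> simp
  conv_lhs => rw [hv]
  simp [pd]

theorem pd_coe {g : R3 → ℝ} {x : R3} (hg : DifferentiableAt ℝ g x) (i : Fin 3) :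
    pd i (fun y => (g y : ℍ[ℝ])) x = ((pd i g x : ℝ) : ℍ[ℝ]) := by
  have h := ((Algebra.linearMap ℝ ℍ[ℝ]).toContinuousLinearMap.hasFDerivAt (x := g x)).comp x
    hg.hasFDerivAt
  have h' : HasFDerivAt (fun y => (g y : ℍ[ℝ])) _ x := h
  rw [pd, h'.fderiv]
  rfl

theorem contDiffOn_pd_s4 {s : Set R3} (ho : IsOpen s) {f : R3 → ℝ} (hf : ContDiffOn ℝ 2 f s)
    (i : Fin 3) : ContDiffOn ℝ 1 (pd i f) s :=
  (hf.fderiv_of_isOpen ho (by norm_num)).clm_apply contDiffOn_const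

theorem pd_pd_coe_s4 {s : Set R3} (ho : IsOpen s) {f : R3 → ℝ} (hf : ContDiffOn ℝ 2 f s)
    {x : R3} (hx : x ∈ s) (i j : Fin 3) :
    pd i (pd j (fun y => (f y : ℍ[ℝ]))) x = ((pd i (pd j f) x : ℝ) : ℍ[ℝ]) := by
  have hev : pd j (fun y => (f y : ℍ[ℝ])) =ᶠ[nhds x] fun y => ((pd j f y : ℝ) : ℍ[ℝ]) := by
    filter_upwards [ho.mem_nhds hx] with y hy
    exact pd_coe ((hf.contDiffAt (ho.mem_nhds hy)).differentiableAt (by norm_num)) j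
  rw [← pd_coe (((contDiffOn_pd_s4 ho hf j).contDiffAt (ho.mem_nhds hx)).differentiableAt
    (by norm_num)) i, pd, hev.fderiv_eq, pd]

theorem pd_comm_s4 {f : R3 → ℝ} {x : R3} (hf : ContDiffAt ℝ 2 f x) (i j : Fin 3) :
    pd i (pd j f) x = pd j (pd i f) x := by
  have hd : DifferentiableAt ℝ (fderiv ℝ f) x :=
    (hf.fderiv_right (m := 1) (by norm_num)).differentiableAt (by norm_num)
  have key : ∀ i j, pd i (pd j f) x = fderiv ℝ (fderiv ℝ f) x (Pi.single i 1) (Pi.single j 1) := by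
    intro i j
    have h := (hd.hasFDerivAt.clm_apply (hasFDerivAt_const (Pi.single j (1 : ℝ) : R3) x)).fderiv
    change fderiv ℝ (fun y => fderiv ℝ f y (Pi.single j 1)) x (Pi.single i 1) = _
    rw [h]
    simp
  rw [key, key]
  exact (hf.isSymmSndFDerivAt (by simp)) _ _

/-- The second-order system equivalent to scalar inframonogenicity. -/
theorem pd_pd_of_sandwichBar_eq_zero {s : Set R3} (ho : IsOpen s) {f : R3 → ℝ}
    (hf : ContDiffOn ℝ 2 f s) {x : R3} (hx : x ∈ s)
    (h : sandwichBar (fun y => (f y : ℍ[ℝ])) x = 0) :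
    pd 0 (pd 0 f) x = pd 1 (pd 1 f) x + pd 2 (pd 2 f) x ∧
      pd 0 (pd 1 f) x = 0 ∧ pd 0 (pd 2 f) x = 0 := by
  have h10 := pd_comm_s4 (hf.contDiffAt (ho.mem_nhds hx)) 1 0
  have h20 := pd_comm_s4 (hf.contDiffAt (ho.mem_nhds hx)) 2 0
  simp only [sandwichBar, pd_pd_coe_s4 ho hf hx, Fin.sum_univ_three] at h
  have hre := congrArg QuaternionAlgebra.re h
  have hi := congrArg QuaternionAlgebra.imI h
  have hj := congrArg QuaternionAlgebra.imJ h
  have h1 : e1.re = 0 ∧ e1.imI = 1 ∧ e1.imJ = 0 ∧ e1.imK = 0 := ⟨rfl, rfl, rfl, rfl⟩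
  have h2 : e2.re = 0 ∧ e2.imI = 0 ∧ e2.imJ = 1 ∧ e2.imK = 0 := ⟨rfl, rfl, rfl, rfl⟩
  simp [eu, h1, h2] at hre hi hj
  exact ⟨by linarith, by linarith, by linarith⟩

/-- Insertion of a fixed zeroth coordinate. -/
def insertZeroth (t : ℝ) (y : Fin 2 → ℝ) : R3 := ![t, y 0, y 1]

theorem hasFDerivAt_insertZeroth (t : ℝ) (y : Fin 2 → ℝ) :
    HasFDerivAt (insertZeroth t) (ContinuousLinearMap.pi
      ![0, ContinuousLinearMap.proj (R := ℝ) (φ := fun _ : Fin 2 => ℝ) 0,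
        ContinuousLinearMap.proj (R := ℝ) (φ := fun _ : Fin 2 => ℝ) 1]) y := by
  rw [hasFDerivAt_pi']
  intro i
  fin_cases i
  · exact hasFDerivAt_const t y
  · exact hasFDerivAt_apply (𝕜 := ℝ) (0 : Fin 2) y
  · exact hasFDerivAt_apply (𝕜 := ℝ) (1 : Fin 2) y

theorem contDiff_insertZeroth (t : ℝ) : ContDiff ℝ 2 (insertZeroth t) := by
  rw [contDiff_pi]
  intro i
  fin_cases i
  · exact contDiff_const
  · exact contDiff_apply ℝ ℝ (0 : Fin 2)
  · exact contDiff_apply ℝ ℝ (1 : Fin 2)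

theorem pd2_comp_insertZeroth {g : R3 → ℝ} {t : ℝ} {y : Fin 2 → ℝ}
    (hg : DifferentiableAt ℝ g (insertZeroth t y)) (i : Fin 2) :
    pd2 i (fun y => g (insertZeroth t y)) y = pd i.succ g (insertZeroth t y) := by
  have h : HasFDerivAt (fun y => g (insertZeroth t y)) _ y :=
    hg.hasFDerivAt.comp y (hasFDerivAt_insertZeroth t y)
  rw [pd2, h.fderiv, pd, ContinuousLinearMap.comp_apply]
  congr 1
  ext j
  fin_cases i <;> fin_cases j <;> simp

theorem pd2_pd2_comp_insertZeroth {s : Set R3} (ho : IsOpen s) {f : R3 → ℝ}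
    (hf : ContDiffOn ℝ 2 f s) {t : ℝ} {y : Fin 2 → ℝ} (hy : insertZeroth t y ∈ s) (i : Fin 2) :
    pd2 i (pd2 i (fun y => f (insertZeroth t y))) y =
      pd i.succ (pd i.succ f) (insertZeroth t y) := by
  have hev : pd2 i (fun y => f (insertZeroth t y)) =ᶠ[nhds y]
      fun y => pd i.succ f (insertZeroth t y) := by
    filter_upwards [(contDiff_insertZeroth t).continuous.continuousAt.eventually_mem
      (ho.mem_nhds hy)] with z hz
    exact pd2_comp_insertZeroth
      ((hf.contDiffAt (ho.mem_nhds hz)).differentiableAt (by norm_num)) i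
  rw [← pd2_comp_insertZeroth (((contDiffOn_pd_s4 ho hf i.succ).contDiffAt
    (ho.mem_nhds hy)).differentiableAt (by norm_num)) i, pd2, hev.fderiv_eq, pd2]

/-- The polynomial part of a scalar inframonogenic function. -/
def inframonogenicPoly (a b : ℝ) (x : R3) : ℝ :=
  a * (2 * (x 0) ^ 2 + (x 1) ^ 2 + (x 2) ^ 2) + b * x 0

theorem contDiff_inframonogenicPoly (a b : ℝ) : ContDiff ℝ 2 (inframonogenicPoly a b) := by
  unfold inframonogenicPoly
  fun_prop

theorem pd_sub {f g : R3 → ℝ} {x : R3} (hf : DifferentiableAt ℝ f x)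
    (hg : DifferentiableAt ℝ g x) (i : Fin 3) :
    pd i (fun y => f y - g y) x = pd i f x - pd i g x := by
  simp [pd, fderiv_fun_sub hf hg]

theorem pd_pd_sub {s : Set R3} (ho : IsOpen s) {f g : R3 → ℝ} (hf : ContDiffOn ℝ 2 f s)
    (hg : ContDiffOn ℝ 2 g s) {x : R3} (hx : x ∈ s) (i j : Fin 3) :
    pd i (pd j (fun y => f y - g y)) x = pd i (pd j f) x - pd i (pd j g) x := by
  have hev : pd j (fun y => f y - g y) =ᶠ[nhds x] fun y => pd j f y - pd j g y := by
    filter_upwards [ho.mem_nhds hx] with y hy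
    exact pd_sub ((hf.contDiffAt (ho.mem_nhds hy)).differentiableAt (by norm_num))
      ((hg.contDiffAt (ho.mem_nhds hy)).differentiableAt (by norm_num)) j
  rw [← pd_sub (((contDiffOn_pd_s4 ho hf j).contDiffAt (ho.mem_nhds hx)).differentiableAt
    (by norm_num)) (((contDiffOn_pd_s4 ho hg j).contDiffAt (ho.mem_nhds hx)).differentiableAt
    (by norm_num)) i, pd, hev.fderiv_eq, pd]

theorem pd_const_mul_apply (a : ℝ) (i j : Fin 3) (x : R3) :
    pd i (fun y => a * y j) x = if i = j then a else 0 := by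
  rw [pd, ((hasFDerivAt_apply (𝕜 := ℝ) j x).const_mul a).fderiv]
  fin_cases i <;> fin_cases j <;> simp

theorem pd_inframonogenicPoly (a b : ℝ) (i : Fin 3) (x : R3) :
    pd i (inframonogenicPoly a b) x = ![4 * a * x 0 + b, 2 * a * x 1, 2 * a * x 2] i := by
  have hp := fun i : Fin 3 => hasFDerivAt_apply (𝕜 := ℝ) i x
  have h : HasFDerivAt (inframonogenicPoly a b) _ x :=
    ((((((hp 0).pow 2).const_mul 2).add ((hp 1).pow 2)).add ((hp 2).pow 2)).const_mul a).add
      ((hp 0).const_mul b)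
  rw [pd, h.fderiv]
  fin_cases i <;> simp <;> ring

theorem insertZeroth_mem_ball {c : R3} {r : ℝ} {x : R3} (hx : x ∈ Metric.ball c r) {t : ℝ}
    (ht : dist t (c 0) < r) : insertZeroth t ![x 1, x 2] ∈ Metric.ball c r := by
  have hr : 0 < r := dist_nonneg.trans_lt ht
  rw [Metric.mem_ball, dist_pi_lt_iff hr] at hx ⊢
  intro i
  fin_cases i
  · exact ht
  · exact hx 1
  · exact hx 2

/-- A scalar-valued C² inframonogenic function on an open ball has the form
`c₀(2x₀² + x₁² + x₂²) + c₁x₀ + c₂ + h(x₁,x₂)` with `h` harmonic in the two variables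
`(x₁,x₂)` (harmonic on the projection of the ball). -/
theorem stmt4 (c : R3) (r : ℝ) (hr : 0 < r) (f0 : R3 → ℝ)
    (hf : ContDiffOn ℝ 2 f0 (Metric.ball c r))
    (hinfra : ∀ x ∈ Metric.ball c r, sandwichBar (fun y => (f0 y : ℍ[ℝ])) x = 0) :
    ∃ (c0 c1 c2 : ℝ) (h : (Fin 2 → ℝ) → ℝ),
      ContDiffOn ℝ 2 h {y : Fin 2 → ℝ | ∃ x ∈ Metric.ball c r, x 1 = y 0 ∧ x 2 = y 1} ∧
      (∀ y ∈ {y : Fin 2 → ℝ | ∃ x ∈ Metric.ball c r, x 1 = y 0 ∧ x 2 = y 1},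
        pd2 0 (pd2 0 h) y + pd2 1 (pd2 1 h) y = 0) ∧
      ∀ x ∈ Metric.ball c r,
        f0 x = c0 * (2 * (x 0)^2 + (x 1)^2 + (x 2)^2) + c1 * x 0 + c2 + h ![x 1, x 2] := by
  set B := Metric.ball c r with hB
  have ho : IsOpen B := Metric.isOpen_ball
  have hconv : Convex ℝ B := convex_ball c r
  have hcB : c ∈ B := Metric.mem_ball_self hr
  have hc0 : dist (c 0) (c 0) < r := by simpa using hr
  have hsys := fun x hx => pd_pd_of_sandwichBar_eq_zero ho hf hx (hinfra x hx)
  have hsymm := fun x hx => pd_comm_s4 (hf.contDiffAt (ho.mem_nhds (x := x) hx))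
  have hdiff : ∀ i, DifferentiableOn ℝ (pd i f0) B := fun i =>
    (contDiffOn_pd_s4 ho hf i).differentiableOn (by norm_num)
  have hD00 : ∀ x ∈ B, pd 0 (pd 0 f0) x = pd 0 (pd 0 f0) c := by
    intro x hx
    have hx0 : dist (x 0) (c 0) < r := (dist_le_pi_dist x c 0).trans_lt hx
    set q : R3 := insertZeroth (x 0) ![c 1, c 2] with hq
    have hqB : q ∈ B := insertZeroth_mem_ball hcB hx0
    have h1 : pd 0 (pd 0 f0) x = pd 0 (pd 0 f0) q := by
      rw [pd, pd, fderiv_eq_of_fderiv_sub_eq_zero hconv ho (hdiff 0) hx hqB]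
      intro z hz
      rw [fderiv_apply_eq_sum_pd, hsymm z hz 1 0, hsymm z hz 2 0, (hsys z hz).2.1,
        (hsys z hz).2.2]
      simp [hq, insertZeroth]
    have h2 : ∀ i, (∀ z ∈ B, pd 0 (pd i f0) z = 0) →
        pd i (pd i f0) q = pd i (pd i f0) c := by
      intro i hi
      rw [pd, pd, fderiv_eq_of_fderiv_sub_eq_zero hconv ho (hdiff i) hqB hcB]
      intro z hz
      rw [fderiv_apply_eq_sum_pd, hi z hz]
      simp [hq, insertZeroth]
    rw [h1, (hsys q hqB).1, h2 1 fun z hz => (hsys z hz).2.1,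
      h2 2 fun z hz => (hsys z hz).2.2, (hsys c hcB).1]
  set a : ℝ := pd 0 (pd 0 f0) c / 4 with ha
  have hgdiff : DifferentiableOn ℝ (fun y : R3 => pd 0 f0 y - 4 * a * y 0) B :=
    (hdiff 0).sub (by fun_prop)
  set b : ℝ := pd 0 f0 c - 4 * a * c 0 with hb
  have hpd0 : ∀ x ∈ B, pd 0 f0 x = 4 * a * x 0 + b := by
    intro x hx
    have h := eq_of_fderiv_sub_eq_zero hconv ho hgdiff hx hcB (by
      intro z hz
      have hsub : ∀ i, pd i (fun y : R3 => pd 0 f0 y - 4 * a * y 0) z =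
          pd i (pd 0 f0) z - if i = 0 then 4 * a else 0 := fun i => by
        rw [pd_sub ((hdiff 0).differentiableAt (ho.mem_nhds hz)) (by fun_prop),
          pd_const_mul_apply]
      rw [fderiv_apply_eq_sum_pd, hsub, hsub, hsub, hD00 z hz, hsymm z hz 1 0, hsymm z hz 2 0,
        (hsys z hz).2.1, (hsys z hz).2.2, ha]
      simp
      right
      ring)
    linarith
  set k : R3 → ℝ := fun x => f0 x - inframonogenicPoly a b x with hk
  have hP : ContDiffOn ℝ 2 (inframonogenicPoly a b) B := (contDiff_inframonogenicPoly a b).contDiffOn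
  have hkC : ContDiffOn ℝ 2 k B := hf.sub hP
  have hlap : ∀ x ∈ B, pd 1 (pd 1 k) x + pd 2 (pd 2 k) x = 0 := by
    intro x hx
    have h1 : pd 1 (inframonogenicPoly a b) = fun y => 2 * a * y 1 :=
      funext fun y => by simpa using pd_inframonogenicPoly a b 1 y
    have h2 : pd 2 (inframonogenicPoly a b) = fun y => 2 * a * y 2 :=
      funext fun y => by simpa using pd_inframonogenicPoly a b 2 y
    rw [hk, pd_pd_sub ho hf hP hx, pd_pd_sub ho hf hP hx, h1, h2, pd_const_mul_apply,
      pd_const_mul_apply, if_pos rfl, if_pos rfl]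
    have := (hsys x hx).1
    rw [hD00 x hx] at this
    rw [ha]
    linarith
  have hkpd0 : ∀ x ∈ B, pd 0 k x = 0 := by
    intro x hx
    rw [hk, pd_sub ((hf.contDiffAt (ho.mem_nhds hx)).differentiableAt (by norm_num))
      ((contDiff_inframonogenicPoly a b).differentiable (by norm_num) x), hpd0 x hx,
      pd_inframonogenicPoly]
    simp
  have hmem : ∀ y ∈ {y : Fin 2 → ℝ | ∃ x ∈ B, x 1 = y 0 ∧ x 2 = y 1},
      insertZeroth (c 0) y ∈ B := by
    rintro y ⟨x, hx, h1, h2⟩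
    have h := insertZeroth_mem_ball hx hc0
    rw [h1, h2] at h
    exact h
  refine ⟨a, b, 0, fun y => k (insertZeroth (c 0) y),
    hkC.comp (contDiff_insertZeroth (c 0)).contDiffOn hmem, fun y hy => ?_, fun x hx => ?_⟩
  · rw [pd2_pd2_comp_insertZeroth ho hkC (hmem y hy),
      pd2_pd2_comp_insertZeroth ho hkC (hmem y hy)]
    exact hlap _ (hmem y hy)
  · have h := eq_of_fderiv_sub_eq_zero hconv ho (hkC.differentiableOn (by norm_num)) hx
      (insertZeroth_mem_ball hx hc0) (fun z hz => by
        rw [fderiv_apply_eq_sum_pd, hkpd0 z hz]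
        simp [insertZeroth])
    change _ = _ + k (insertZeroth (c 0) ![x 1, x 2])
    rw [← h]
    simp only [hk, inframonogenicPoly]
    ring
end
end

section
/- Let Ω ⊆ ℝ³ be open and let f : Ω → ℍ be a C² function taking values in the reduced quaternions which is monogenic (∂̄f = 0). Then ∂̄(|x|²f)∂̄ = −2f̄, where |x|² = x₀² + x₁² + x₂² and f̄ = f₀ − f₁e₁ − f₂e₂ is the quaternionic conjugate of f. -/
open Quaternion

noncomputable section

section PartialDerivatives

variable {E F : Type*} [NormedAddCommGroup E] [NormedSpace ℝ E]
  [NormedAddCommGroup F] [NormedSpace ℝ F] {Ω : Set R3} {x : R3}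

theorem pd_congr_of_eqOn (hΩ : IsOpen Ω) (hx : x ∈ Ω) {f g : R3 → E} (h : Set.EqOn f g Ω)
    (i : Fin 3) : pd i f x = pd i g x := by
  unfold pd
  rw [(h.eventuallyEq_of_mem (hΩ.mem_nhds hx)).fderiv_eq]

theorem pd_add {f g : R3 → E} (hf : DifferentiableAt ℝ f x) (hg : DifferentiableAt ℝ g x)
    (i : Fin 3) : pd i (fun y => f y + g y) x = pd i f x + pd i g x := by
  simp [pd, fderiv_fun_add hf hg]

theorem pd_smul {c : R3 → ℝ} {f : R3 → E} (hc : DifferentiableAt ℝ c x)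
    (hf : DifferentiableAt ℝ f x) (i : Fin 3) :
    pd i (fun y => c y • f y) x = c x • pd i f x + pd i c x • f x := by
  simp [pd, fderiv_fun_smul hc hf]

theorem pd_clm_comp (L : E →L[ℝ] F) {f : R3 → E} (hf : DifferentiableAt ℝ f x) (i : Fin 3) :
    pd i (fun y => L (f y)) x = L (pd i f x) := by
  have h := (L.hasFDerivAt.comp x hf.hasFDerivAt).fderiv
  simp only [Function.comp_def] at h
  simp [pd, h]

theorem pd_mul_const {f : R3 → ℍ[ℝ]} (hf : DifferentiableAt ℝ f x) (q : ℍ[ℝ]) (i : Fin 3) :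
    pd i (fun y => f y * q) x = pd i f x * q :=
  pd_clm_comp ((ContinuousLinearMap.mul ℝ ℍ[ℝ]).flip q) hf i

theorem pd_const (c : E) (i : Fin 3) : pd i (fun _ => c) x = 0 := by
  simp [pd]

theorem pd_two_mul_coord (i j : Fin 3) :
    pd i (fun y : R3 => 2 * y j) x = if i = j then 2 else 0 := by
  rw [show (fun y : R3 => 2 * y j) =
    fun y => ((2 : ℝ) • ContinuousLinearMap.proj (R := ℝ) (φ := fun _ : Fin 3 => ℝ) j) y from rfl]
  simp only [pd, ContinuousLinearMap.fderiv]
  simp [Pi.single_apply, eq_comm]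

theorem differentiable_normSq : Differentiable ℝ fun y : R3 => (y 0)^2 + (y 1)^2 + (y 2)^2 := by
  fun_prop

theorem pd_normSq (i : Fin 3) : pd i (fun y : R3 => (y 0)^2 + (y 1)^2 + (y 2)^2) x = 2 * x i := by
  have h (j : Fin 3) : HasFDerivAt (fun y : R3 => y j)
      (ContinuousLinearMap.proj (R := ℝ) (φ := fun _ : Fin 3 => ℝ) j) x :=
    (ContinuousLinearMap.proj (R := ℝ) (φ := fun _ : Fin 3 => ℝ) j).hasFDerivAt
  unfold pd
  rw [((((h 0).pow 2).fun_add ((h 1).pow 2)).fun_add ((h 2).pow 2)).fderiv]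
  fin_cases i <;> simp

theorem differentiableAt_pd (hΩ : IsOpen Ω) {f : R3 → E} (hf : ContDiffOn ℝ 2 f Ω) (hx : x ∈ Ω)
    (i : Fin 3) : DifferentiableAt ℝ (pd i f) x := by
  have h : ContDiffAt ℝ 1 (fderiv ℝ f) x :=
    (hf.contDiffAt (hΩ.mem_nhds hx)).fderiv_right (by norm_num)
  exact (h.differentiableAt (by norm_num)).clm_apply (differentiableAt_const _)

theorem pd_pd_normSq_smul (hΩ : IsOpen Ω) {f : R3 → E} (hf : ContDiffOn ℝ 2 f Ω) (hx : x ∈ Ω)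
    (i j : Fin 3) :
    pd i (pd j fun y => ((y 0)^2 + (y 1)^2 + (y 2)^2) • f y) x =
      ((x 0)^2 + (x 1)^2 + (x 2)^2) • pd i (pd j f) x + (2 * x i) • pd j f x
        + ((2 * x j) • pd i f x + (if i = j then (2 : ℝ) else 0) • f x) := by
  have hd : ∀ y ∈ Ω, DifferentiableAt ℝ f y := fun y hy =>
    (hf.contDiffAt (hΩ.mem_nhds hy)).differentiableAt (by norm_num)
  have hc : DifferentiableAt ℝ (fun y : R3 => 2 * y j) x := by fun_prop
  have h1 : Set.EqOn (pd j fun y => ((y 0)^2 + (y 1)^2 + (y 2)^2) • f y)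
      (fun y => ((y 0)^2 + (y 1)^2 + (y 2)^2) • pd j f y + (2 * y j) • f y) Ω := by
    intro y hy
    simp only [pd_smul (differentiable_normSq y) (hd y hy), pd_normSq]
  have hp := differentiableAt_pd hΩ hf hx j
  rw [pd_congr_of_eqOn hΩ hx h1,
    pd_add ((differentiable_normSq x).fun_smul hp) (hc.fun_smul (hd x hx)),
    pd_smul (differentiable_normSq x) hp, pd_smul hc (hd x hx), pd_normSq, pd_two_mul_coord]

end PartialDerivatives

theorem e1_components : e1.re = 0 ∧ e1.imI = 1 ∧ e1.imJ = 0 ∧ e1.imK = 0 :=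
  ⟨rfl, rfl, rfl, rfl⟩

theorem e2_components : e2.re = 0 ∧ e2.imI = 0 ∧ e2.imJ = 1 ∧ e2.imK = 0 :=
  ⟨rfl, rfl, rfl, rfl⟩

theorem imK_pd_eq_zero {Ω : Set R3} (hΩ : IsOpen Ω) {f : R3 → ℍ[ℝ]}
    (hred : ∀ x ∈ Ω, (f x).imK = 0) {x : R3} (hx : x ∈ Ω) (hf : DifferentiableAt ℝ f x)
    (i : Fin 3) : (pd i f x).imK = 0 := by
  let L : ℍ[ℝ] →ₗ[ℝ] ℝ :=
    { toFun := fun q => q.imK, map_add' := fun _ _ => rfl, map_smul' := fun _ _ => rfl }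
  have h := pd_clm_comp (LinearMap.toContinuousLinearMap L) hf i
  exact h.symm.trans ((pd_congr_of_eqOn hΩ hx (g := fun _ => (0 : ℝ)) hred i).trans (pd_const 0 i))

/-- For reduced quaternions, left and right monogenicity coincide. -/
theorem DbarR_eq_zero {f : R3 → ℍ[ℝ]} {x : R3} (hred : ∀ i, (pd i f x).imK = 0)
    (hmono : DbarL f x = 0) : DbarR f x = 0 := by
  simp only [DbarL, DbarR, Quaternion.ext_iff] at hmono ⊢
  simp [Quaternion.re_mul, Quaternion.imI_mul, Quaternion.imJ_mul, Quaternion.imK_mul,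
    e1_components, e2_components,
    hred] at hmono ⊢
  obtain ⟨h0, h1, h2, h3⟩ := hmono
  refine ⟨?_, ?_, ?_, ?_⟩ <;> linarith

theorem pd_DbarR {f : R3 → ℍ[ℝ]} {x : R3} (hf : ∀ j, DifferentiableAt ℝ (pd j f) x) (i : Fin 3) :
    pd i (DbarR f) x = pd i (pd 0 f) x + pd i (pd 1 f) x * e1 + pd i (pd 2 f) x * e2 := by
  unfold DbarR
  rw [pd_add ((hf 0).fun_add ((hf 1).mul_const e1)) ((hf 2).mul_const e2),
    pd_add (hf 0) ((hf 1).mul_const e1), pd_mul_const (hf 1), pd_mul_const (hf 2)]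

theorem sum_eu_mul_mul_eu {q : ℍ[ℝ]} (hq : q.imK = 0) : ∑ i, eu i * q * eu i = -star q := by
  ext <;> simp [Quaternion.re_mul, Quaternion.imI_mul, Quaternion.imJ_mul, Quaternion.imK_mul,
    Fin.sum_univ_three, eu, e1_components, e2_components, hq]

/-- for a C² monogenic reduced-quaternion-valued `f`,
`∂̄(|x|²f)∂̄ = −2f̄` where `f̄` is the quaternionic conjugate of `f`. -/
theorem stmt8 (Ω : Set R3) (hΩ : IsOpen Ω) (f : R3 → ℍ[ℝ])
    (hf : ContDiffOn ℝ 2 f Ω)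
    (hred : ∀ x ∈ Ω, (f x).imK = 0)
    (hmono : ∀ x ∈ Ω, DbarL f x = 0) :
    ∀ x ∈ Ω,
      sandwichBar (fun y => (((y 0)^2 + (y 1)^2 + (y 2)^2 : ℝ) : ℍ[ℝ]) * f y) x
        = -2 * star (f x) := by
  intro x hx
  have hd : DifferentiableAt ℝ f x :=
    (hf.contDiffAt (hΩ.mem_nhds hx)).differentiableAt (by norm_num)
  have hR : Set.EqOn (DbarR f) (fun _ => 0) Ω := fun y hy =>
    DbarR_eq_zero (imK_pd_eq_zero hΩ hred hy
      ((hf.contDiffAt (hΩ.mem_nhds hy)).differentiableAt (by norm_num))) (hmono y hy)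
  have hRx : ∑ j, pd j f x * eu j = 0 := by
    simpa [Fin.sum_univ_three, eu, DbarR] using hR hx
  have hLx : ∑ i, eu i * pd i f x = 0 := by
    simpa [Fin.sum_univ_three, eu, DbarL] using hmono x hx
  have hRR (i : Fin 3) : ∑ j, pd i (pd j f) x * eu j = 0 := by
    have h := pd_DbarR (differentiableAt_pd hΩ hf hx) i
    rw [pd_congr_of_eqOn hΩ hx hR, pd_const] at h
    simpa [Fin.sum_univ_three, eu] using h.symm
  have key (i : Fin 3) :
      ∑ j, eu i * pd i (pd j fun y => ((y 0)^2 + (y 1)^2 + (y 2)^2) • f y) x * eu j =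
        eu i * pd i f x * ∑ j, (2 * x j) • eu j + (2 : ℝ) • (eu i * f x * eu i) := by
    simp only [pd_pd_normSq_smul hΩ hf hx, mul_add, add_mul, Finset.sum_add_distrib,
      mul_smul_comm, smul_mul_assoc, mul_assoc, ← Finset.smul_sum, ← Finset.mul_sum, hRx, hRR,
      mul_zero, smul_zero, zero_add]
    simp [Finset.mul_sum, ite_smul]
  simp only [Quaternion.coe_mul_eq_smul, sandwichBar, key, Finset.sum_add_distrib,
    ← Finset.sum_mul, ← Finset.smul_sum, hLx, zero_mul, zero_add, sum_eu_mul_mul_eu (hred x hx)]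
  rw [smul_neg, two_smul, neg_mul, two_mul]
end
end

section
/- For every natural number n, the real vector space of reduced-quaternion-valued monogenic homogeneous polynomials of degree n has dimension 2n + 3 over ℝ. -/
noncomputable section

open MvPolynomial

/-- The space of real polynomials in the three variables `x₀, x₁, x₂`. -/
abbrev P3 := MvPolynomial (Fin 3) ℝ

/-- The partial derivative `∂ᵢ` as a linear operator on polynomials. -/
noncomputable def Dp (i : Fin 3) : P3 →ₗ[ℝ] P3 :=
  (MvPolynomial.pderiv i).toLinearMap

/-- The linear map expressing the system `∂̄f = 0` for a reduced-quaternion-valued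
polynomial `f = f₀ + f₁e₁ + f₂e₂` (a triple of real polynomials): its kernel consists
of the triples satisfying `∂₀f₀ − ∂₁f₁ − ∂₂f₂ = 0`, `∂₀f₁ + ∂₁f₀ = 0`,
`∂₀f₂ + ∂₂f₀ = 0`, and `∂₁f₂ − ∂₂f₁ = 0`. -/
noncomputable def monoSystem : (Fin 3 → P3) →ₗ[ℝ] (Fin 4 → P3) :=
  LinearMap.pi ![
    Dp 0 ∘ₗ LinearMap.proj 0 - Dp 1 ∘ₗ LinearMap.proj 1 - Dp 2 ∘ₗ LinearMap.proj 2,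
    Dp 0 ∘ₗ LinearMap.proj 1 + Dp 1 ∘ₗ LinearMap.proj 0,
    Dp 0 ∘ₗ LinearMap.proj 2 + Dp 2 ∘ₗ LinearMap.proj 0,
    Dp 1 ∘ₗ LinearMap.proj 2 - Dp 2 ∘ₗ LinearMap.proj 1 ]

/-- The real vector space of reduced-quaternion-valued monogenic homogeneous
polynomials of degree `n`, as triples `(f₀, f₁, f₂)` of homogeneous polynomials of
degree `n` satisfying `∂̄f = 0`. -/
noncomputable def Mono (n : ℕ) : Submodule ℝ (Fin 3 → P3) :=
  (Submodule.pi Set.univ fun _ : Fin 3 => MvPolynomial.homogeneousSubmodule (Fin 3) ℝ n)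
    ⊓ LinearMap.ker monoSystem

open scoped Nat

/-- The exponent of the monomial `x₀ᵃ x₁ᵇ x₂ᶜ`. -/
def expo (a b c : ℕ) : Fin 3 →₀ ℕ := Finsupp.equivFunOnFinite.symm ![a, b, c]

@[simp] lemma expo_zero (a b c : ℕ) : expo a b c 0 = a := rfl

@[simp] lemma expo_one (a b c : ℕ) : expo a b c 1 = b := rfl

@[simp] lemma expo_two (a b c : ℕ) : expo a b c 2 = c := rfl

lemma expo_eta (d : Fin 3 →₀ ℕ) : expo (d 0) (d 1) (d 2) = d := by
  ext i
  fin_cases i <;> rfl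

@[simp] lemma degree_expo (a b c : ℕ) : (expo a b c).degree = a + b + c := by
  simp [Finsupp.degree_eq_sum, Fin.sum_univ_three]

lemma P3_ext {p q : P3} (h : ∀ a b c, coeff (expo a b c) p = coeff (expo a b c) q) : p = q := by
  ext d
  simpa [expo_eta] using h (d 0) (d 1) (d 2)

lemma coeff_Dp_zero (p : P3) (a b c : ℕ) :
    coeff (expo a b c) (Dp 0 p) = coeff (expo (a + 1) b c) p * (a + 1) := by
  have h : expo a b c + Finsupp.single 0 1 = expo (a + 1) b c := by
    ext i
    fin_cases i <;> simp
  simp [Dp, coeff_pderiv, h]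

lemma coeff_Dp_one (p : P3) (a b c : ℕ) :
    coeff (expo a b c) (Dp 1 p) = coeff (expo a (b + 1) c) p * (b + 1) := by
  have h : expo a b c + Finsupp.single 1 1 = expo a (b + 1) c := by
    ext i
    fin_cases i <;> simp
  simp [Dp, coeff_pderiv, h]

lemma coeff_Dp_two (p : P3) (a b c : ℕ) :
    coeff (expo a b c) (Dp 2 p) = coeff (expo a b (c + 1)) p * (c + 1) := by
  have h : expo a b c + Finsupp.single 2 1 = expo a b (c + 1) := by
    ext i
    fin_cases i <;> simp
  simp [Dp, coeff_pderiv, h]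

lemma mem_Mono_iff {n : ℕ} {f : Fin 3 → P3} :
    f ∈ Mono n ↔ (∀ i, (f i).IsHomogeneous n) ∧
      Dp 0 (f 0) - Dp 1 (f 1) - Dp 2 (f 2) = 0 ∧ Dp 0 (f 1) + Dp 1 (f 0) = 0 ∧
      Dp 0 (f 2) + Dp 2 (f 0) = 0 ∧ Dp 1 (f 2) - Dp 2 (f 1) = 0 := by
  simp [Mono, monoSystem, Submodule.mem_pi, funext_iff, Fin.forall_fin_succ]

/-- The homogeneous polynomial `∑ F a b c x₀ᵃ x₁ᵇ x₂ᶜ / (a! b! c!)` of degree `n`. -/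
def taylorPoly (n : ℕ) (F : ℕ → ℕ → ℝ) : P3 :=
  ∑ d ∈ Finset.finsuppAntidiag Finset.univ n,
    monomial d (F (d 0) (d 1) / ((d 0)! * (d 1)! * (d 2)!))

lemma coeff_taylorPoly (n : ℕ) (F : ℕ → ℕ → ℝ) (a b c : ℕ) :
    coeff (expo a b c) (taylorPoly n F) =
      if a + b + c = n then F a b / (a ! * b ! * c !) else 0 := by
  simp [taylorPoly, coeff_sum, coeff_monomial, Fin.sum_univ_three]

lemma isHomogeneous_taylorPoly (n : ℕ) (F : ℕ → ℕ → ℝ) : (taylorPoly n F).IsHomogeneous n := by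
  refine IsHomogeneous.sum _ _ _ fun d hd => isHomogeneous_monomial _ ?_
  rw [Finsupp.degree_eq_sum]
  exact (Finset.mem_finsuppAntidiag.mp hd).1

lemma coeff_Dp_zero_taylorPoly (n : ℕ) (F : ℕ → ℕ → ℝ) (a b c : ℕ) :
    coeff (expo a b c) (Dp 0 (taylorPoly n F)) =
      if a + b + c + 1 = n then F (a + 1) b / (a ! * b ! * c !) else 0 := by
  rw [coeff_Dp_zero, coeff_taylorPoly, show a + 1 + b + c = a + b + c + 1 by ring]
  split_ifs
  · rw [Nat.factorial_succ]
    push_cast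
    field_simp
  · simp

lemma coeff_Dp_one_taylorPoly (n : ℕ) (F : ℕ → ℕ → ℝ) (a b c : ℕ) :
    coeff (expo a b c) (Dp 1 (taylorPoly n F)) =
      if a + b + c + 1 = n then F a (b + 1) / (a ! * b ! * c !) else 0 := by
  rw [coeff_Dp_one, coeff_taylorPoly, show a + (b + 1) + c = a + b + c + 1 by ring]
  split_ifs
  · rw [Nat.factorial_succ]
    push_cast
    field_simp
  · simp

lemma coeff_Dp_two_taylorPoly (n : ℕ) (F : ℕ → ℕ → ℝ) (a b c : ℕ) :
    coeff (expo a b c) (Dp 2 (taylorPoly n F)) =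
      if a + b + c + 1 = n then F a b / (a ! * b ! * c !) else 0 := by
  rw [coeff_Dp_two, coeff_taylorPoly, show a + b + (c + 1) = a + b + c + 1 by ring]
  split_ifs
  · rw [Nat.factorial_succ]
    push_cast
    field_simp
  · simp

/-- The derivatives at the origin, of order `a` in `x₀` and `b` in `x₁`, of the homogeneous
harmonic polynomial with Cauchy data `v`, `w` on the plane `x₀ = 0`. -/
def harmonicCoeff (v w : ℕ → ℝ) : ℕ → ℕ → ℝ
  | 0, b => v b
  | 1, b => w b
  | a + 2, b => -(harmonicCoeff v w a (b + 2) + harmonicCoeff v w a b)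

/-- The conjugated gradient of a homogeneous harmonic polynomial of degree `n + 1`. -/
def harmonicGrad (n : ℕ) (v w : ℕ → ℝ) : Fin 3 → P3 :=
  ![taylorPoly n fun a b => harmonicCoeff v w (a + 1) b,
    taylorPoly n fun a b => -harmonicCoeff v w a (b + 1),
    taylorPoly n fun a b => -harmonicCoeff v w a b]

lemma harmonicGrad_mem_Mono (n : ℕ) (v w : ℕ → ℝ) : harmonicGrad n v w ∈ Mono n := by
  rw [mem_Mono_iff]
  refine ⟨fun i => ?_, ?_, ?_, ?_, ?_⟩
  · fin_cases i
    · exact isHomogeneous_taylorPoly n fun a b => harmonicCoeff v w (a + 1) b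
    · exact isHomogeneous_taylorPoly n fun a b => -harmonicCoeff v w a (b + 1)
    · exact isHomogeneous_taylorPoly n fun a b => -harmonicCoeff v w a b
  all_goals
    refine P3_ext fun a b c => ?_
    simp only [harmonicGrad, Matrix.cons_val, coeff_add, coeff_sub, coeff_zero,
      coeff_Dp_zero_taylorPoly, coeff_Dp_one_taylorPoly, coeff_Dp_two_taylorPoly, harmonicCoeff]
    split_ifs <;> ring

/-- The coefficients of a monogenic polynomial that determine it. -/
def cauchyData (n : ℕ) : Mono n →ₗ[ℝ] (Fin (n + 1) → ℝ) × (Fin (n + 1) → ℝ) × ℝ :=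
  LinearMap.prod
    (LinearMap.pi fun b => lcoeff ℝ (expo 0 b (n - b)) ∘ₗ LinearMap.proj 0 ∘ₗ (Mono n).subtype)
    (LinearMap.prod
      (LinearMap.pi fun b => lcoeff ℝ (expo 0 b (n - b)) ∘ₗ LinearMap.proj 2 ∘ₗ (Mono n).subtype)
      (lcoeff ℝ (expo 0 n 0) ∘ₗ LinearMap.proj 1 ∘ₗ (Mono n).subtype))

lemma cauchyData_apply (n : ℕ) (f : Mono n) :
    cauchyData n f = (fun b : Fin (n + 1) => coeff (expo 0 b (n - b)) (f.1 0),
      fun b : Fin (n + 1) => coeff (expo 0 b (n - b)) (f.1 2), coeff (expo 0 n 0) (f.1 1)) := rfl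

lemma coeff_eq_zero_of_cauchyData {n : ℕ} {f : Fin 3 → P3} (hf : f ∈ Mono n)
    (h0 : ∀ b ≤ n, coeff (expo 0 b (n - b)) (f 0) = 0)
    (h2 : ∀ b ≤ n, coeff (expo 0 b (n - b)) (f 2) = 0)
    (h1 : coeff (expo 0 n 0) (f 1) = 0) (a : ℕ) :
    ∀ i b c, coeff (expo a b c) (f i) = 0 := by
  obtain ⟨hom, e0, e1, e2, e3⟩ := mem_Mono_iff.mp hf
  induction a with
  | zero =>
    have hz (i) (h : ∀ b ≤ n, coeff (expo 0 b (n - b)) (f i) = 0) (b c) :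
        coeff (expo 0 b c) (f i) = 0 := by
      by_cases hd : b + c = n
      · obtain rfl : c = n - b := by omega
        exact h b (by omega)
      · exact (hom i).coeff_eq_zero (by simpa using hd)
    refine Fin.forall_fin_succ.mpr ⟨hz 0 h0, Fin.forall_fin_two.mpr ⟨fun b c => ?_, hz 2 h2⟩⟩
    cases c with
    | zero =>
      by_cases hd : b = n
      · subst hd
        exact h1
      · exact (hom 1).coeff_eq_zero (by simpa using hd)
    | succ c =>
      have h := congrArg (coeff (expo 0 b c)) e3
      simp only [coeff_sub, coeff_Dp_one, coeff_Dp_two, hz 2 h2, coeff_zero, zero_mul,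
        zero_sub, neg_eq_zero, mul_eq_zero] at h
      exact h.resolve_right (by positivity)
  | succ a ih =>
    refine Fin.forall_fin_succ.mpr ⟨fun b c => ?_, Fin.forall_fin_two.mpr ⟨fun b c => ?_,
      fun b c => ?_⟩⟩
    · have h := congrArg (coeff (expo a b c)) e0
      simp only [coeff_sub, coeff_Dp_zero, coeff_Dp_one, coeff_Dp_two, ih, coeff_zero, zero_mul,
        sub_zero, mul_eq_zero] at h
      exact h.resolve_right (by positivity)
    · have h := congrArg (coeff (expo a b c)) e1
      simp only [coeff_add, coeff_Dp_zero, coeff_Dp_one, ih, coeff_zero, zero_mul,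
        add_zero, mul_eq_zero] at h
      exact h.resolve_right (by positivity)
    · have h := congrArg (coeff (expo a b c)) e2
      simp only [coeff_add, coeff_Dp_zero, coeff_Dp_two, ih, coeff_zero, zero_mul,
        add_zero, mul_eq_zero] at h
      exact h.resolve_right (by positivity)

lemma cauchyData_injective (n : ℕ) : Function.Injective (cauchyData n) := by
  rw [injective_iff_map_eq_zero]
  rintro ⟨f, hf⟩ h
  simp only [cauchyData_apply, Prod.mk_eq_zero] at h
  obtain ⟨h0, h2, h1⟩ := h
  have hc := coeff_eq_zero_of_cauchyData hf
    (fun b hb => congrFun h0 ⟨b, Nat.lt_succ_of_le hb⟩)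
    (fun b hb => congrFun h2 ⟨b, Nat.lt_succ_of_le hb⟩) h1
  exact Subtype.ext (funext fun i => P3_ext fun a b c => hc a i b c)

lemma cauchyData_surjective (n : ℕ) : Function.Surjective (cauchyData n) := by
  rintro ⟨α, β, t⟩
  refine ⟨⟨harmonicGrad n
    (fun b => if h : b < n + 1 then -(β ⟨b, h⟩ * (b ! * (n - b)!)) else -(t * n !))
    (fun b => if h : b < n + 1 then α ⟨b, h⟩ * (b ! * (n - b)!) else 0),
    harmonicGrad_mem_Mono _ _ _⟩, ?_⟩
  rw [cauchyData_apply]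
  simp only [harmonicGrad, Matrix.cons_val, coeff_taylorPoly, Prod.mk.injEq]
  refine ⟨funext fun b => ?_, funext fun b => ?_, ?_⟩
  · rw [if_pos (by omega)]
    simp [harmonicCoeff, b.is_le]
    field_simp
  · rw [if_pos (by omega)]
    simp [harmonicCoeff, b.is_le]
    field_simp
  · rw [if_pos (by omega)]
    simp [harmonicCoeff]
    field_simp

/-- the space of reduced-quaternion-valued monogenic homogeneous
polynomials of degree `n` has dimension `2n + 3` over `ℝ`. -/
theorem stmt15 (n : ℕ) : Module.finrank ℝ (Mono n) = 2 * n + 3 := by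
  rw [(LinearEquiv.ofBijective (cauchyData n)
    ⟨cauchyData_injective n, cauchyData_surjective n⟩).finrank_eq]
  simp only [Module.finrank_prod, Module.finrank_fin_fun, Module.finrank_self]
  ring
end
end
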